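/- arXiv:2008.05222 — 3 statements merged into one kernel-verified Lean document; each statement's English description precedes it below -/
import Mathlib

section
/- Let d ≥ 1, α ∈ (0,2], and let ν be a finite, symmetric, non-zero Borel measure on the unit sphere S ⊂ ℝ^d satisfying the spanning assumption. Then e^{−ψ^α_ν} decays faster than any polynomial at infinity: for every n ∈ ℕ one has sup_{z ∈ ℝ^d} (1+|z|)^n e^{−ψ^α_ν(z)} < ∞. -/
open MeasureTheory Complex Filter Topology Set
open scoped RealInnerProductSpace FourierTransform SchwartzMap ENNReal NNReal

noncomputable section

abbrev Ed (d : ℕ) := EuclideanSpace ℝ (Fin d)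

/-- `ψ^α_ν(z) = ∫_S |⟨z,ξ⟩|^α ν(dξ)`. -/
def psiNu {d : ℕ} (ν : Measure (Ed d)) (α : ℝ) (z : Ed d) : ℝ :=
  ∫ ξ, (|(⟪z, ξ⟫ : ℝ)|) ^ α ∂ν

/-- symmetry of the measure `ν`: `ν(A) = ν(−A)`. -/
def SymmMeasure {d : ℕ} (ν : Measure (Ed d)) : Prop :=
  Measure.map (fun x => -x) ν = ν

/-- `ν` is concentrated on the unit sphere. -/
def OnSphere {d : ℕ} (ν : Measure (Ed d)) : Prop :=
  ν (Metric.sphere (0 : Ed d) 1)ᶜ = 0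

/-- the linear span of the (topological) support of `ν` is all of `ℝ^d`. -/
def SpanningSupport {d : ℕ} (ν : Measure (Ed d)) : Prop :=
  Submodule.span ℝ {x : Ed d | ∀ U ∈ 𝓝 x, 0 < ν U} = ⊤

theorem integrable_abs_inner_rpow {d : ℕ} {ν : Measure (Ed d)} [IsFiniteMeasure ν]
    (hsph : OnSphere ν) {α : ℝ} (hα : 0 < α) (z : Ed d) :
    Integrable (fun ξ => |(⟪z, ξ⟫ : ℝ)| ^ α) ν := by
  have hmem : ∀ᵐ ξ ∂ν, ξ ∈ Metric.sphere (0 : Ed d) 1 := hsph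
  have hcont : Continuous fun ξ : Ed d => |(⟪z, ξ⟫ : ℝ)| ^ α :=
    (continuous_const.inner continuous_id).abs.rpow_const fun _ => Or.inr hα.le
  refine Integrable.of_bound hcont.aestronglyMeasurable (‖z‖ ^ α) ?_
  filter_upwards [hmem] with ξ hξ
  rw [Real.norm_of_nonneg (by positivity)]
  refine Real.rpow_le_rpow (abs_nonneg _) ?_ hα.le
  simpa [mem_sphere_zero_iff_norm.1 hξ] using abs_real_inner_le_norm z ξ

theorem psiNu_pos {d : ℕ} {ν : Measure (Ed d)} [IsFiniteMeasure ν] (hsph : OnSphere ν)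
    (hspan : SpanningSupport ν) {α : ℝ} (hα : 0 < α) {z : Ed d} (hz : z ≠ 0) :
    0 < psiNu ν α z := by
  obtain ⟨x, hx, hzx⟩ : ∃ x ∈ {x : Ed d | ∀ U ∈ 𝓝 x, 0 < ν U}, (⟪z, x⟫ : ℝ) ≠ 0 := by
    by_contra! h
    have hle : (⊤ : Submodule ℝ (Ed d)) ≤ LinearMap.ker (innerSL ℝ z).toLinearMap := by
      rw [← hspan, Submodule.span_le]
      intro x hx
      simpa using h x hx
    have hzz : z ∈ LinearMap.ker (innerSL ℝ z).toLinearMap := hle Submodule.mem_top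
    exact hz (by simpa using hzz)
  rw [psiNu, integral_pos_iff_support_of_nonneg (fun ξ => by positivity)
    (integrable_abs_inner_rpow hsph hα z)]
  refine hx _ ?_
  have hcont : Continuous fun ξ : Ed d => (⟪z, ξ⟫ : ℝ) := continuous_const.inner continuous_id
  filter_upwards [hcont.continuousAt.eventually_ne hzx] with ξ hξ
  exact (Real.rpow_pos_of_pos (abs_pos.2 hξ) α).ne'

theorem continuousOn_psiNu_sphere {d : ℕ} {ν : Measure (Ed d)} [IsFiniteMeasure ν]
    (hsph : OnSphere ν) {α : ℝ} (hα : 0 < α) :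
    ContinuousOn (psiNu ν α) (Metric.sphere 0 1) := by
  have hmem : ∀ᵐ ξ ∂ν, ξ ∈ Metric.sphere (0 : Ed d) 1 := hsph
  refine continuousOn_of_dominated (bound := fun _ => 1)
    (fun z _ => (integrable_abs_inner_rpow hsph hα z).aestronglyMeasurable)
    (fun z hz => ?_) (integrable_const _) (ae_of_all _ fun ξ => ?_)
  · filter_upwards [hmem] with ξ hξ
    rw [Real.norm_of_nonneg (by positivity)]
    refine Real.rpow_le_one (abs_nonneg _) ?_ hα.le
    simpa [mem_sphere_zero_iff_norm.1 hξ, mem_sphere_zero_iff_norm.1 hz] using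
      abs_real_inner_le_norm z ξ
  · exact ((continuous_id.inner continuous_const).abs.rpow_const
      fun _ => Or.inr hα.le).continuousOn

theorem psiNu_smul {d : ℕ} (ν : Measure (Ed d)) (α : ℝ) {r : ℝ} (hr : 0 ≤ r) (z : Ed d) :
    psiNu ν α (r • z) = r ^ α * psiNu ν α z := by
  simp only [psiNu, ← integral_const_mul]
  congr 1 with ξ
  rw [real_inner_smul_left, abs_mul, abs_of_nonneg hr, Real.mul_rpow hr (abs_nonneg _)]

theorem exists_mul_norm_rpow_le_psiNu {d : ℕ} {ν : Measure (Ed d)} [IsFiniteMeasure ν]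
    (hsph : OnSphere ν) (hspan : SpanningSupport ν) {α : ℝ} (hα : 0 < α) :
    ∃ c > 0, ∀ z : Ed d, c * ‖z‖ ^ α ≤ psiNu ν α z := by
  obtain ⟨c, hc, hle⟩ := (isCompact_sphere (0 : Ed d) 1).exists_forall_le'
    (continuousOn_psiNu_sphere hsph hα) (a := 0) fun z hz =>
      psiNu_pos hsph hspan hα (ne_zero_of_mem_unit_sphere ⟨z, hz⟩)
  refine ⟨c, hc, fun z => ?_⟩
  rcases eq_or_ne z 0 with rfl | hz
  · rw [norm_zero, Real.zero_rpow hα.ne', mul_zero]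
    exact integral_nonneg fun ξ => Real.rpow_nonneg (abs_nonneg _) α
  · have hz' : ‖z‖ ≠ 0 := norm_ne_zero_iff.2 hz
    have hunit : ‖z‖⁻¹ • z ∈ Metric.sphere (0 : Ed d) 1 := by
      simp [norm_smul, hz']
    have hsplit : psiNu ν α z = ‖z‖ ^ α * psiNu ν α (‖z‖⁻¹ • z) := by
      rw [← psiNu_smul ν α (norm_nonneg z), smul_inv_smul₀ hz']
    rw [hsplit, mul_comm]
    gcongr
    exact hle _ hunit

theorem exists_one_add_pow_mul_exp_neg_rpow_le {c α : ℝ} (hc : 0 < c) (hα : 0 < α) (n : ℕ) :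
    ∃ M : ℝ, ∀ r : ℝ, 0 ≤ r → (1 + r) ^ n * Real.exp (-(c * r ^ α)) ≤ M := by
  obtain ⟨m, hm⟩ := exists_nat_ge (n / α)
  refine ⟨2 ^ n * (1 + m.factorial / c ^ m), fun r hr => ?_⟩
  rw [Real.exp_neg, ← div_eq_mul_inv, div_le_iff₀ (Real.exp_pos _)]
  have hexp : 1 ≤ Real.exp (c * r ^ α) := Real.one_le_exp (by positivity)
  rcases le_total r 1 with h1 | h1
  · calc (1 + r) ^ n ≤ 2 ^ n * (1 + 0) * 1 := by
          rw [add_zero, mul_one, mul_one]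
          gcongr
          linarith
      _ ≤ _ := by
          gcongr
          positivity
  · have hpow : r ^ n ≤ (r ^ α) ^ m := by
      rw [← Real.rpow_natCast, ← Real.rpow_mul_natCast hr]
      exact Real.rpow_le_rpow_of_exponent_le h1 ((div_le_iff₀' hα).1 hm)
    have hfac : (r ^ α) ^ m ≤ m.factorial / c ^ m * Real.exp (c * r ^ α) := by
      have := Real.pow_div_factorial_le_exp (c * r ^ α) (by positivity) m
      rw [div_le_iff₀ (by positivity), mul_pow] at this
      rw [div_mul_eq_mul_div, le_div_iff₀ (by positivity)]
      linarith
    calc (1 + r) ^ n ≤ (2 * r) ^ n := by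
          gcongr
          linarith
      _ = 2 ^ n * r ^ n := mul_pow _ _ _
      _ ≤ 2 ^ n * (m.factorial / c ^ m * Real.exp (c * r ^ α)) := by
          gcongr
          exact hpow.trans hfac
      _ ≤ 2 ^ n * ((1 + m.factorial / c ^ m) * Real.exp (c * r ^ α)) := by
          gcongr
          linarith
      _ = _ := by ring

/-- Under the spanning assumption, `e^{−ψ^α_ν}` decays faster than any
polynomial at infinity: for every `n`, `sup_z (1+|z|)^n e^{−ψ^α_ν(z)} < ∞`. -/
theorem stmt1 {d : ℕ} (hd : 1 ≤ d) {α : ℝ} (hα : α ∈ Set.Ioc (0 : ℝ) 2)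
    (ν : Measure (Ed d)) [IsFiniteMeasure ν]
    (hsym : SymmMeasure ν) (hsph : OnSphere ν) (hne : ν ≠ 0)
    (hspan : SpanningSupport ν) :
    ∀ n : ℕ, ∃ M : ℝ, ∀ z : Ed d, (1 + ‖z‖) ^ n * Real.exp (-psiNu ν α z) ≤ M := by
  intro n
  obtain ⟨c, hc, hle⟩ := exists_mul_norm_rpow_le_psiNu hsph hspan hα.1
  obtain ⟨M, hM⟩ := exists_one_add_pow_mul_exp_neg_rpow_le hc hα.1 n
  refine ⟨M, fun z => le_trans ?_ (hM ‖z‖ (norm_nonneg z))⟩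
  gcongr
  exact hle z

end
end

section
/- Let d ≥ 1, α ∈ (0,2), and let ν be a finite, symmetric, non-zero Borel measure on the unit sphere S ⊂ ℝ^d. Then there exists a constant C > 0 such that for every φ ∈ C_b^∞(ℝ^d) and every x ∈ ℝ^d, F^{−1}(ψ^α_ν · Fφ)(x) = −C ∫_S ∫_0^∞ ( φ(x+kξ) − φ(x) − 1_{{k ≤ 1}} k ⟨∇φ(x), ξ⟩ ) k^{−1−α} dk ν(dξ). Equivalently, −L^α_ν coincides on C_b^∞(ℝ^d) with the integro-differential operator Aφ(x) = ∫_{ℝ^d} ( φ(x+y) − φ(x) − 1_{{|y| ≤ 1}} ⟨∇φ(x), y⟩ ) μ(dy), where μ(A) := C ∫_S ∫_0^∞ 1_A(kξ) k^{−1−α} dk ν(dξ). -/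
open MeasureTheory Complex Filter Topology Set
open scoped RealInnerProductSpace FourierTransform SchwartzMap ENNReal NNReal

noncomputable section

/-- `φ ∈ C_b^∞`: smooth with bounded derivatives of all orders. -/
def CbSmooth {d : ℕ} (φ : Ed d → ℝ) : Prop :=
  ContDiff ℝ (⊤ : ℕ∞) φ ∧ ∀ n : ℕ, ∃ M : ℝ, ∀ x, ‖iteratedFDeriv ℝ n φ x‖ ≤ M

/-- The integro-differential (Lévy) operator associated to `ν`, `α` and a constant `C`:
`A φ(x) = −C ∫_S ∫_0^∞ (φ(x+kξ) − φ(x) − 1_{k≤1} k ⟨∇φ(x),ξ⟩) k^{−1−α} dk ν(dξ)`. -/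
def levyOp {d : ℕ} (ν : Measure (Ed d)) (α C : ℝ) (φ : Ed d → ℝ) (x : Ed d) : ℝ :=
  -C * ∫ ξ, (∫ k in Set.Ioi (0 : ℝ),
      (φ (x + k • ξ) - φ x - (if k ≤ 1 then k * fderiv ℝ φ x ξ else 0)) * k ^ (-1 - α)) ∂ν

section LevyMeasure

variable {E F : Type*} [NormedAddCommGroup E] [NormedAddCommGroup F] [NormedSpace ℝ F]

/-- The symmetric second difference `f (x + h) + f (x - h) - 2 f x`. -/
def secondDiff (f : E → F) (h x : E) : F :=
  f (x + h) + f (x - h) - (2 : ℝ) • f x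

/-- The truncated square `min 1 ‖h‖²` against which Lévy measures are finite. -/
def levyWeight (h : E) : ℝ := min 1 (‖h‖ ^ 2)

lemma levyWeight_of_le {h : E} (hh : ‖h‖ ≤ 1) : levyWeight h = ‖h‖ ^ 2 :=
  min_eq_right (pow_le_one₀ (norm_nonneg h) hh)

lemma levyWeight_of_lt {h : E} (hh : 1 < ‖h‖) : levyWeight h = 1 :=
  min_eq_left (one_le_pow₀ hh.le)

lemma one_sub_cos_le_mul_min {a b c : ℝ} (hc : c ^ 2 ≤ a ^ 2 * b ^ 2) :
    1 - Real.cos (2 * Real.pi * c) ≤ 2 * Real.pi ^ 2 * (1 + a ^ 2) * min 1 (b ^ 2) := by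
  have hpi : 1 ≤ Real.pi ^ 2 := one_le_pow₀ (by linarith [Real.pi_gt_three])
  rcases le_total 1 (b ^ 2) with hb | hb
  · rw [min_eq_left hb]
    nlinarith [Real.neg_one_le_cos (2 * Real.pi * c), mul_nonneg (sq_nonneg Real.pi) (sq_nonneg a)]
  · rw [min_eq_right hb]
    have := Real.one_sub_sq_div_two_le_cos (x := 2 * Real.pi * c)
    nlinarith [mul_nonneg (sq_nonneg Real.pi) (sq_nonneg b),
      mul_le_mul_of_nonneg_left hc (sq_nonneg Real.pi)]

lemma continuous_uncurry_secondDiff {f : E → F} (hf : Continuous f) :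
    Continuous fun p : E × E => secondDiff f p.2 p.1 := by
  unfold secondDiff
  fun_prop

variable [NormedSpace ℝ E]

lemma norm_taylor_remainder_le {f : E → F} (hf : ContDiff ℝ 2 f) {x h : E} {M : ℝ}
    (hM : ∀ y ∈ Metric.closedBall x ‖h‖, ‖iteratedFDeriv ℝ 2 f y‖ ≤ M) :
    ‖f (x + h) - f x - fderiv ℝ f x h‖ ≤ M * ‖h‖ ^ 2 := by
  have hM0 : 0 ≤ M := (norm_nonneg _).trans (hM x (Metric.mem_closedBall_self (norm_nonneg h)))
  have hx : x ∈ Metric.closedBall x ‖h‖ := Metric.mem_closedBall_self (norm_nonneg h)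
  have hd : Differentiable ℝ (fderiv ℝ f) :=
    (hf.fderiv_right (m := 1) (by norm_num)).differentiable (by norm_num)
  have h1 : ∀ y ∈ Metric.closedBall x ‖h‖, ‖fderiv ℝ f y - fderiv ℝ f x‖ ≤ M * ‖h‖ := by
    intro y hy
    refine (Convex.norm_image_sub_le_of_norm_fderiv_le (𝕜 := ℝ) (C := M) (fun z _ => hd z) (fun z hz => ?_)
      (convex_closedBall x ‖h‖) hx hy).trans ?_
    · rw [← norm_iteratedFDeriv_one, norm_iteratedFDeriv_fderiv]
      exact hM z hz
    · gcongr
      rwa [mem_closedBall_iff_norm] at hy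
  have h2 := Convex.norm_image_sub_le_of_norm_fderiv_le' (𝕜 := ℝ) (f := f) (y := x + h)
    (fun z _ => hf.differentiable (by norm_num) z) h1 (convex_closedBall x ‖h‖) hx (by simp)
  simpa [sq, mul_assoc] using h2

lemma norm_secondDiff_le {f : E → F} (hf : ContDiff ℝ 2 f) {x h : E} {M : ℝ}
    (hM : ∀ y ∈ Metric.closedBall x ‖h‖, ‖iteratedFDeriv ℝ 2 f y‖ ≤ M) :
    ‖secondDiff f h x‖ ≤ 2 * M * ‖h‖ ^ 2 := by
  have h1 := norm_taylor_remainder_le hf hM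
  have h2 := norm_taylor_remainder_le (h := -h) hf (by simpa using hM)
  have h3 : secondDiff f h x = (f (x + h) - f x - fderiv ℝ f x h)
      + (f (x + -h) - f x - fderiv ℝ f x (-h)) := by
    simp only [secondDiff, map_neg, sub_eq_add_neg, two_smul]
    abel
  rw [h3]
  refine (norm_add_le _ _).trans ?_
  rw [norm_neg] at h2
  linarith

/-- Integrand of the Lévy operator: first-order Taylor remainder compensated on `‖h‖ ≤ 1`. -/
def levyIntegrand (f : E → F) (x h : E) : F :=
  f (x + h) - f x - (if ‖h‖ ≤ 1 then fderiv ℝ f x h else 0)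

lemma levyIntegrand_add_neg (f : E → F) (x h : E) :
    levyIntegrand f x h + levyIntegrand f x (-h) = secondDiff f h x := by
  unfold levyIntegrand secondDiff
  rw [norm_neg]
  split_ifs <;> simp only [map_neg, sub_eq_add_neg, two_smul, neg_zero] <;> abel

lemma norm_levyIntegrand_le {f : E → F} (hf : ContDiff ℝ 2 f) {M₀ M₂ : ℝ}
    (hM₀ : ∀ x, ‖f x‖ ≤ M₀) (hM₂ : ∀ x, ‖iteratedFDeriv ℝ 2 f x‖ ≤ M₂) (x h : E) :
    ‖levyIntegrand f x h‖ ≤ (2 * M₀ + M₂) * levyWeight h := by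
  have h0 : 0 ≤ M₀ := (norm_nonneg _).trans (hM₀ x)
  have h2 : 0 ≤ M₂ := (norm_nonneg _).trans (hM₂ x)
  rcases le_or_gt ‖h‖ 1 with hh | hh
  · rw [levyWeight_of_le hh, levyIntegrand, if_pos hh]
    refine (norm_taylor_remainder_le hf fun y _ => hM₂ y).trans ?_
    gcongr
    linarith
  · rw [levyWeight_of_lt hh, levyIntegrand, if_neg hh.not_ge, sub_zero]
    refine (norm_sub_le _ _).trans ?_
    linarith [hM₀ (x + h), hM₀ x]

lemma norm_secondDiff_le_levyWeight {f : E → F} (hf : ContDiff ℝ 2 f) {M₀ M₂ : ℝ}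
    (hM₀ : ∀ x, ‖f x‖ ≤ M₀) (hM₂ : ∀ x, ‖iteratedFDeriv ℝ 2 f x‖ ≤ M₂) (h x : E) :
    ‖secondDiff f h x‖ ≤ 2 * (2 * M₀ + M₂) * levyWeight h := by
  rw [← levyIntegrand_add_neg]
  have h1 := norm_levyIntegrand_le hf hM₀ hM₂ x h
  have h2 := norm_levyIntegrand_le hf hM₀ hM₂ x (-h)
  have h3 : levyWeight (-h) = levyWeight h := by simp [levyWeight]
  rw [h3] at h2
  refine (norm_add_le _ _).trans ?_
  linarith

lemma SchwartzMap.exists_norm_secondDiff_le (g : 𝓢(E, F)) (r : ℕ) :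
    ∃ C, 0 ≤ C ∧ ∀ h x : E, ‖h‖ ≤ 1 →
      ‖secondDiff g h x‖ ≤ C * (1 + ‖x‖) ^ (-(r : ℝ)) * ‖h‖ ^ 2 := by
  set K := 2 ^ r * ((Finset.Iic (r, 2)).sup fun m => SchwartzMap.seminorm ℝ m.1 m.2) g with hK
  have hg : ∀ y : E, (1 + ‖y‖) ^ r * ‖iteratedFDeriv ℝ 2 g y‖ ≤ K := fun y =>
    SchwartzMap.one_add_le_sup_seminorm_apply (𝕜 := ℝ) (m := (r, 2)) le_rfl le_rfl g y
  have hK0 : 0 ≤ K := le_trans (by positivity) (hg 0)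
  refine ⟨2 * (2 ^ r * K), by positivity, fun h x hh => ?_⟩
  have hx : 0 < 1 + ‖x‖ := by positivity
  have := norm_secondDiff_le (f := g) (x := x) (h := h)
    (M := 2 ^ r * K * (1 + ‖x‖) ^ (-(r : ℝ))) (g.smooth 2) (fun y hy => ?_)
  · linarith
  rw [Real.rpow_neg hx.le, Real.rpow_natCast, ← div_eq_mul_inv, le_div_iff₀ (by positivity)]
  have hxy : 1 + ‖x‖ ≤ 2 * (1 + ‖y‖) := by
    have h1 : ‖y - x‖ ≤ 1 := (mem_closedBall_iff_norm.1 hy).trans hh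
    have h2 := norm_sub_norm_le x y
    rw [norm_sub_rev] at h2
    linarith [norm_nonneg y]
  calc ‖iteratedFDeriv ℝ 2 g y‖ * (1 + ‖x‖) ^ r
      ≤ ‖iteratedFDeriv ℝ 2 g y‖ * (2 * (1 + ‖y‖)) ^ r := by gcongr
    _ = 2 ^ r * ((1 + ‖y‖) ^ r * ‖iteratedFDeriv ℝ 2 g y‖) := by rw [mul_pow]; ring
    _ ≤ 2 ^ r * K := by gcongr; exact hg y

end LevyMeasure

lemma integral_add_add_const_mul {X 𝕜 : Type*} [MeasurableSpace X] {μ : Measure X} [RCLike 𝕜]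
    {f₁ f₂ f₃ : X → 𝕜} (h₁ : Integrable f₁ μ) (h₂ : Integrable f₂ μ) (h₃ : Integrable f₃ μ)
    (c : 𝕜) : ∫ x, (f₁ x + f₂ x + c * f₃ x) ∂μ
      = (∫ x, f₁ x ∂μ) + (∫ x, f₂ x ∂μ) + c * ∫ x, f₃ x ∂μ := by
  rw [← integral_const_mul, ← integral_add h₁ h₂]
  exact integral_add (h₁.add h₂) (h₃.const_mul c)

section LevyFubini

variable {E : Type*} [NormedAddCommGroup E] [InnerProductSpace ℝ E]

lemma norm_one_sub_cos_inner_le (z h : E) :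
    ‖1 - Real.cos (2 * Real.pi * ⟪z, h⟫)‖ ≤ 2 * Real.pi ^ 2 * (1 + ‖z‖ ^ 2) * levyWeight h := by
  rw [Real.norm_of_nonneg (by linarith [Real.cos_le_one (2 * Real.pi * ⟪z, h⟫)])]
  refine one_sub_cos_le_mul_min ?_
  rw [← mul_pow, ← sq_abs]
  exact pow_le_pow_left₀ (abs_nonneg _) (abs_real_inner_le_norm z h) 2

variable [MeasurableSpace E] [BorelSpace E]

lemma integral_levyIntegrand_of_symm {μ : Measure E} (hsymm : μ.map (fun x => -x) = μ) {φ : E → ℝ}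
    (hφ : ∀ x, Integrable (levyIntegrand φ x) μ) (x : E) :
    ∫ h, levyIntegrand φ x h ∂μ = 1 / 2 * ∫ h, secondDiff φ h x ∂μ := by
  have hmp : MeasurePreserving (fun x : E => -x) μ μ := ⟨measurable_neg, hsymm⟩
  have h1 : ∫ h, levyIntegrand φ x (-h) ∂μ = ∫ h, levyIntegrand φ x h ∂μ :=
    hmp.integral_comp (MeasurableEquiv.neg E).measurableEmbedding _
  have h2 : Integrable (fun h => levyIntegrand φ x (-h)) μ :=
    hmp.integrable_comp_of_integrable (hφ x)
  simp_rw [← levyIntegrand_add_neg]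
  rw [integral_add (hφ x) h2, h1]
  ring

lemma integrable_levyIntegrand {μ : Measure E} (hμ : Integrable levyWeight μ) {φ : E → ℝ}
    (hφ : ContDiff ℝ 2 φ) {M₀ M₂ : ℝ} (hM₀ : ∀ x, ‖φ x‖ ≤ M₀)
    (hM₂ : ∀ x, ‖iteratedFDeriv ℝ 2 φ x‖ ≤ M₂) (x : E) :
    Integrable (levyIntegrand φ x) μ := by
  have hc := hφ.continuous
  refine (hμ.const_mul (2 * M₀ + M₂)).mono' (Measurable.aestronglyMeasurable ?_)
    (ae_of_all _ fun h => norm_levyIntegrand_le hφ hM₀ hM₂ x h)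
  refine (by fun_prop : Continuous fun h => φ (x + h) - φ x).measurable.sub ?_
  exact Measurable.ite (measurableSet_le measurable_norm measurable_const)
    (fderiv ℝ φ x).measurable measurable_const


/-- The symbol `z ↦ ∫ (1 - cos (2π ⟪z, h⟫)) μ(dh)` of a symmetric Lévy measure `μ`. -/
def levySymbol (μ : Measure E) (z : E) : ℝ := ∫ h, (1 - Real.cos (2 * Real.pi * ⟪z, h⟫)) ∂μ

lemma integrable_one_sub_cos_inner {μ : Measure E} (hμ : Integrable levyWeight μ) (z : E) :
    Integrable (fun h => 1 - Real.cos (2 * Real.pi * ⟪z, h⟫)) μ :=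
  (hμ.const_mul (2 * Real.pi ^ 2 * (1 + ‖z‖ ^ 2))).mono'
    (Continuous.aestronglyMeasurable (by fun_prop))
    (ae_of_all _ fun h => norm_one_sub_cos_inner_le z h)

variable [FiniteDimensional ℝ E]

lemma SchwartzMap.fourierInv_one_sub_cos_mul (g : 𝓢(E, ℂ)) (h x : E) :
    ∫ z, cexp (((2 * Real.pi * ⟪z, x⟫ : ℝ) : ℂ) * I) *
      (((1 - Real.cos (2 * Real.pi * ⟪z, h⟫) : ℝ) : ℂ) * 𝓕 (⇑g) z)
      = -(1 / 2) * secondDiff g h x := by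
  have hinv : ∀ y : E, ∫ z, cexp (((2 * Real.pi * ⟪z, y⟫ : ℝ) : ℂ) * I) * 𝓕 (⇑g) z = g y := by
    intro y
    have h1 := congrArg (fun f : 𝓢(E, ℂ) => f y) (FourierPair.fourierInv_fourier_eq (F := 𝓢(E, ℂ)) g)
    simp only [SchwartzMap.fourierInv_coe, SchwartzMap.fourier_coe] at h1
    rw [← h1, Real.fourierInv_eq']
    simp only [smul_eq_mul]
  have hint : ∀ y : E, Integrable fun z : E =>
      cexp (((2 * Real.pi * ⟪z, y⟫ : ℝ) : ℂ) * I) * 𝓕 (⇑g) z := by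
    intro y
    have h1 : Integrable (𝓕 (⇑g)) (volume : Measure E) := by
      rw [← SchwartzMap.fourier_coe]
      exact (𝓕 g).integrable
    refine h1.norm.mono' ((Continuous.aestronglyMeasurable (by fun_prop)).mul
      h1.aestronglyMeasurable) (ae_of_all _ fun z => ?_)
    rw [norm_mul, Complex.norm_exp_ofReal_mul_I, one_mul]
  have hpt : ∀ z : E, cexp (((2 * Real.pi * ⟪z, x⟫ : ℝ) : ℂ) * I) *
      (((1 - Real.cos (2 * Real.pi * ⟪z, h⟫) : ℝ) : ℂ) * 𝓕 (⇑g) z)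
      = -(1 / 2) * (cexp (((2 * Real.pi * ⟪z, x + h⟫ : ℝ) : ℂ) * I) * 𝓕 (⇑g) z
          + cexp (((2 * Real.pi * ⟪z, x - h⟫ : ℝ) : ℂ) * I) * 𝓕 (⇑g) z
          + -2 * (cexp (((2 * Real.pi * ⟪z, x⟫ : ℝ) : ℂ) * I) * 𝓕 (⇑g) z)) := by
    intro z
    have e1 : cexp (((2 * Real.pi * ⟪z, x + h⟫ : ℝ) : ℂ) * I)
        = cexp (((2 * Real.pi * ⟪z, x⟫ : ℝ) : ℂ) * I)
          * cexp (((2 * Real.pi * ⟪z, h⟫ : ℝ) : ℂ) * I) := by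
      rw [← Complex.exp_add, inner_add_right]
      push_cast
      ring_nf
    have e2 : cexp (((2 * Real.pi * ⟪z, x - h⟫ : ℝ) : ℂ) * I)
        = cexp (((2 * Real.pi * ⟪z, x⟫ : ℝ) : ℂ) * I)
          * cexp (-((2 * Real.pi * ⟪z, h⟫ : ℝ) : ℂ) * I) := by
      rw [← Complex.exp_add, inner_sub_right]
      push_cast
      ring_nf
    rw [e1, e2, Complex.ofReal_sub, Complex.ofReal_one, Complex.ofReal_cos, Complex.cos]
    ring
  simp_rw [hpt]
  rw [integral_const_mul, integral_add_add_const_mul (hint _) (hint _) (hint _), hinv, hinv, hinv]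
  simp only [secondDiff, Complex.real_smul]
  push_cast
  ring

lemma SchwartzMap.fourierInv_levySymbol_mul_fourier {μ : Measure E} [SFinite μ]
    (hμ : Integrable levyWeight μ) (g : 𝓢(E, ℂ)) (x : E) :
    𝓕⁻ (fun z : E => (levySymbol μ z : ℂ) * 𝓕 (⇑g) z) x
      = -(1 / 2) * ∫ h, secondDiff g h x ∂μ := by
  rw [Real.fourierInv_eq', ← integral_const_mul]
  simp_rw [← SchwartzMap.fourierInv_one_sub_cos_mul g _ x]
  rw [← integral_integral_swap]
  · refine integral_congr_ae (ae_of_all _ fun z => ?_)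
    simp only [smul_eq_mul]
    rw [integral_const_mul, integral_mul_const, integral_complex_ofReal, levySymbol]
  · have hG : Integrable (fun z : E => 2 * Real.pi ^ 2 * (‖𝓕 g z‖ + ‖z‖ ^ 2 * ‖𝓕 g z‖)) :=
      ((𝓕 g).integrable.norm.add ((𝓕 g).integrable_pow_mul volume 2)).const_mul _
    refine (hG.mul_prod hμ).mono' (Continuous.aestronglyMeasurable ?_)
      (ae_of_all _ fun p => ?_)
    · have : Continuous (𝓕 (⇑g)) := by
        rw [← SchwartzMap.fourier_coe]
        exact (𝓕 g).continuous
      simp only [Function.uncurry_def]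
      fun_prop
    · have h1 := norm_one_sub_cos_inner_le p.1 p.2
      simp only [Function.uncurry_def, norm_mul, Complex.norm_exp_ofReal_mul_I, one_mul,
        Complex.norm_real, ← SchwartzMap.fourier_coe]
      calc _ ≤ 2 * Real.pi ^ 2 * (1 + ‖p.1‖ ^ 2) * levyWeight p.2 * ‖𝓕 g p.1‖ := by gcongr
        _ = _ := by ring

lemma SchwartzMap.exists_integral_norm_secondDiff_le (g : 𝓢(E, ℂ)) :
    ∃ K, ∀ h : E, ∫ x, ‖secondDiff g h x‖ ≤ K * levyWeight h := by
  obtain ⟨C, hC0, hC⟩ := SchwartzMap.exists_norm_secondDiff_le g (Module.finrank ℝ E + 1)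
  set W : E → ℝ := fun x => (1 + ‖x‖) ^ (-((Module.finrank ℝ E + 1 : ℕ) : ℝ))
  have hW : Integrable W := integrable_one_add_norm (by push_cast; linarith)
  have hW0 : 0 ≤ ∫ x, W x := integral_nonneg fun x => by positivity
  have hg0 : 0 ≤ ∫ x, ‖g x‖ := integral_nonneg fun x => norm_nonneg _
  refine ⟨C * (∫ x, W x) + 4 * ∫ x, ‖g x‖, fun h => ?_⟩
  rcases le_or_gt ‖h‖ 1 with hh | hh
  · rw [levyWeight_of_le hh]
    calc ∫ x, ‖secondDiff g h x‖ ≤ ∫ x, C * ‖h‖ ^ 2 * W x :=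
          integral_mono_of_nonneg (ae_of_all _ fun x => norm_nonneg _) (hW.const_mul _)
            (ae_of_all _ fun x => (hC h x hh).trans_eq (by simp only [W]; ring))
      _ = C * (∫ x, W x) * ‖h‖ ^ 2 := by rw [integral_const_mul]; ring
      _ ≤ _ := by gcongr; linarith
  · rw [levyWeight_of_lt hh, mul_one]
    have hi : Integrable fun x => ‖g x‖ := g.integrable.norm
    calc ∫ x, ‖secondDiff g h x‖ ≤ ∫ x, (‖g (x + h)‖ + ‖g (x - h)‖ + 2 * ‖g x‖) :=
          integral_mono_of_nonneg (ae_of_all _ fun x => norm_nonneg _)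
            (((hi.comp_add_right h).add (hi.comp_sub_right h)).add (hi.const_mul 2))
            (ae_of_all _ fun x => by
              refine (norm_sub_le _ _).trans ?_
              rw [norm_smul, Real.norm_of_nonneg zero_le_two]
              exact add_le_add_left (norm_add_le _ _) _)
      _ = 4 * ∫ x, ‖g x‖ := by
          rw [integral_add_add_const_mul (hi.comp_add_right h) (hi.comp_sub_right h) hi,
            integral_add_right_eq_self (fun x => ‖g x‖) h,
            integral_sub_right_eq_self (fun x => ‖g x‖) h]
          ring
      _ ≤ _ := by nlinarith

lemma integral_mul_secondDiff_comm {φ g : E → ℂ} (hφ : Continuous φ) {M : ℝ}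
    (hM : ∀ x, ‖φ x‖ ≤ M) (hg : Integrable g) (h : E) :
    ∫ x, φ x * secondDiff g h x = ∫ x, secondDiff φ h x * g x := by
  have hb : ∀ u : E, Integrable fun x => φ x * g (x + u) := fun u =>
    (hg.comp_add_right u).bdd_mul hφ.aestronglyMeasurable (ae_of_all _ hM)
  have hb' : ∀ u : E, Integrable fun x => φ (x + u) * g x := fun u =>
    hg.bdd_mul (by fun_prop : Continuous fun x => φ (x + u)).aestronglyMeasurable
      (ae_of_all _ fun x => hM (x + u))
  have hs : ∀ u : E, ∫ x, φ x * g (x + u) = ∫ x, φ (x + -u) * g x := by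
    intro u
    rw [← integral_add_right_eq_self (fun x => φ (x + -u) * g x) u]
    simp
  have h0 : Integrable fun x => φ x * g x := by simpa using hb 0
  have e1 : ∀ x, φ x * secondDiff g h x
      = φ x * g (x + h) + φ x * g (x + -h) + -2 * (φ x * g x) := by
    intro x
    simp only [secondDiff, Complex.real_smul, sub_eq_add_neg]
    push_cast
    ring
  have e2 : ∀ x, secondDiff φ h x * g x
      = φ (x + h) * g x + φ (x + -h) * g x + -2 * (φ x * g x) := by
    intro x
    simp only [secondDiff, Complex.real_smul, sub_eq_add_neg]
    push_cast
    ring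
  simp_rw [e1, e2]
  rw [integral_add_add_const_mul (hb h) (hb (-h)) h0,
    integral_add_add_const_mul (hb' h) (hb' (-h)) h0, hs h, hs (-h), neg_neg]
  ring

lemma SchwartzMap.integral_mul_integral_secondDiff_comm {μ : Measure E} [SFinite μ]
    (hμ : Integrable levyWeight μ) {φ : E → ℂ} (hφ : ContDiff ℝ 2 φ) {M₀ M₂ : ℝ}
    (hM₀ : ∀ x, ‖φ x‖ ≤ M₀) (hM₂ : ∀ x, ‖iteratedFDeriv ℝ 2 φ x‖ ≤ M₂) (g : 𝓢(E, ℂ)) :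
    ∫ x, φ x * ∫ h, secondDiff g h x ∂μ = ∫ x, (∫ h, secondDiff φ h x ∂μ) * g x := by
  have hcφ := continuous_uncurry_secondDiff hφ.continuous
  have hcg := continuous_uncurry_secondDiff g.continuous
  simp_rw [← integral_const_mul, ← integral_mul_const]
  rw [integral_integral_swap, integral_integral_swap (f := fun x h => secondDiff φ h x * g x)]
  · exact integral_congr_ae (ae_of_all _ fun h =>
      integral_mul_secondDiff_comm hφ.continuous hM₀ g.integrable h)
  · refine ((g.integrable.norm.const_mul (2 * (2 * M₀ + M₂))).mul_prod hμ).mono'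
      (Continuous.aestronglyMeasurable
        (hcφ.mul (g.continuous.comp continuous_fst))) (ae_of_all _ fun p => ?_)
    simp only [Function.uncurry_def, norm_mul]
    calc _ ≤ 2 * (2 * M₀ + M₂) * levyWeight p.2 * ‖g p.1‖ := by
          gcongr
          exact norm_secondDiff_le_levyWeight hφ hM₀ hM₂ _ _
      _ = _ := by ring
  · obtain ⟨K, hK⟩ := SchwartzMap.exists_integral_norm_secondDiff_le g
    have hmeas : AEStronglyMeasurable (Function.uncurry fun x h => φ x * secondDiff g h x)
        ((volume : Measure E).prod μ) :=
      Continuous.aestronglyMeasurable ((hφ.continuous.comp continuous_fst).mul hcg)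
    have hM0 : 0 ≤ M₀ := (norm_nonneg _).trans (hM₀ 0)
    have hig : ∀ h, Integrable fun x => secondDiff g h x := fun h =>
      ((g.integrable.comp_add_right h).add (g.integrable.comp_sub_right h)).sub
        (g.integrable.smul (2 : ℝ))
    rw [integrable_prod_iff' hmeas]
    refine ⟨ae_of_all _ fun h =>
      (hig h).bdd_mul hφ.continuous.aestronglyMeasurable (ae_of_all _ hM₀), ?_⟩
    refine (hμ.const_mul (M₀ * K)).mono' hmeas.norm.prod_swap.integral_prod_right'
      (ae_of_all _ fun h => ?_)
    rw [Real.norm_of_nonneg (integral_nonneg fun x => norm_nonneg _), mul_assoc]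
    refine le_trans ?_ (mul_le_mul_of_nonneg_left (hK h) hM0)
    rw [← integral_const_mul]
    refine integral_mono_of_nonneg (ae_of_all _ fun x => norm_nonneg _)
      ((hig h).norm.const_mul _) (ae_of_all _ fun x => ?_)
    simp only [Function.uncurry_def, norm_mul]
    gcongr
    exact hM₀ x

end LevyFubini

section Stable

/-- The radial part `k^(-1-α) dk` on `(0, ∞)` of an `α`-stable Lévy measure. -/
def stableRadial (α : ℝ) : Measure ℝ :=
  (volume.restrict (Ioi 0)).withDensity fun k => ENNReal.ofReal (k ^ (-1 - α))

instance (α : ℝ) : SFinite (stableRadial α) :=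
  inferInstanceAs (SFinite ((volume.restrict (Ioi 0)).withDensity _))

lemma measurable_ofReal_rpow (r : ℝ) : Measurable fun k : ℝ => ENNReal.ofReal (k ^ r) := by
  fun_prop

lemma integral_stableRadial (α : ℝ) (f : ℝ → ℝ) :
    ∫ k, f k ∂stableRadial α = ∫ k in Ioi (0 : ℝ), f k * k ^ (-1 - α) := by
  rw [stableRadial, integral_withDensity_eq_integral_toReal_smul (measurable_ofReal_rpow _)
    (ae_of_all _ fun _ => ENNReal.ofReal_lt_top)]
  refine setIntegral_congr_fun measurableSet_Ioi fun k hk => ?_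
  rw [ENNReal.toReal_ofReal (Real.rpow_nonneg (le_of_lt hk) _), smul_eq_mul, mul_comm]

lemma integrable_stableRadial_iff (α : ℝ) (f : ℝ → ℝ) :
    Integrable f (stableRadial α) ↔ IntegrableOn (fun k => f k * k ^ (-1 - α)) (Ioi 0) := by
  rw [stableRadial, integrable_withDensity_iff_integrable_smul' (measurable_ofReal_rpow _)
    (ae_of_all _ fun _ => ENNReal.ofReal_lt_top)]
  refine integrableOn_congr_fun (fun k hk => ?_) measurableSet_Ioi
  rw [ENNReal.toReal_ofReal (Real.rpow_nonneg (le_of_lt hk) _), smul_eq_mul, mul_comm]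

lemma ae_stableRadial_pos (α : ℝ) : ∀ᵐ k ∂stableRadial α, 0 < k :=
  (withDensity_absolutelyContinuous _ _).ae_le (ae_restrict_mem measurableSet_Ioi)

variable {α : ℝ}

lemma integrable_levyWeight_stableRadial (hα : α ∈ Ioo (0 : ℝ) 2) :
    Integrable (levyWeight : ℝ → ℝ) (stableRadial α) := by
  rw [integrable_stableRadial_iff, ← Ioc_union_Ioi_eq_Ioi zero_le_one]
  refine IntegrableOn.union ?_ ?_
  · have h1 : IntegrableOn (fun k : ℝ => k ^ (1 - α)) (Ioc 0 1) :=
      (intervalIntegrable_iff_integrableOn_Ioc_of_le zero_le_one).1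
        (intervalIntegral.intervalIntegrable_rpow' (by linarith [hα.2]))
    refine h1.congr_fun (fun k hk => ?_) measurableSet_Ioc
    have hk' : ‖k‖ ≤ 1 := by rw [Real.norm_of_nonneg hk.1.le]; exact hk.2
    rw [levyWeight_of_le hk', Real.norm_of_nonneg hk.1.le, ← Real.rpow_natCast,
      ← Real.rpow_add hk.1]
    ring_nf
  · refine (integrableOn_Ioi_rpow_of_lt (a := -1 - α) (by linarith [hα.1]) one_pos).congr_fun
      (fun k hk => ?_) measurableSet_Ioi
    have hk' : 1 < ‖k‖ := hk.trans_le (le_abs_self k)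
    rw [levyWeight_of_lt hk', one_mul]

lemma integrable_one_sub_cos_stableRadial (hα : α ∈ Ioo (0 : ℝ) 2) (a : ℝ) :
    Integrable (fun k => 1 - Real.cos (2 * Real.pi * (a * k))) (stableRadial α) := by
  refine ((integrable_levyWeight_stableRadial hα).const_mul
    (2 * Real.pi ^ 2 * (1 + a ^ 2))).mono' (Continuous.aestronglyMeasurable (by fun_prop))
    (ae_of_all _ fun k => ?_)
  rw [Real.norm_of_nonneg (by linarith [Real.cos_le_one (2 * Real.pi * (a * k))]), levyWeight,
    Real.norm_eq_abs, sq_abs]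
  exact one_sub_cos_le_mul_min (mul_pow a k 2).le

/-- The total symbol `∫₀^∞ (1 - cos (2πk)) k^(-1-α) dk` at `1`. -/
def stableConst (α : ℝ) : ℝ := ∫ k, (1 - Real.cos (2 * Real.pi * k)) ∂stableRadial α

lemma stableConst_pos (hα : α ∈ Ioo (0 : ℝ) 2) : 0 < stableConst α := by
  have hint := integrable_one_sub_cos_stableRadial hα 1
  simp only [one_mul] at hint
  rw [stableConst, integral_stableRadial, setIntegral_pos_iff_support_of_nonneg_ae
    (ae_restrict_of_forall_mem measurableSet_Ioi fun k hk => ?_)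
    ((integrable_stableRadial_iff _ _).1 hint)]
  · have hsub : Ioo (0 : ℝ) 1 ⊆ Function.support
        (fun k : ℝ => (1 - Real.cos (2 * Real.pi * k)) * k ^ (-1 - α)) ∩ Ioi 0 := by
      refine fun k hk => ⟨mul_ne_zero (fun h => ?_) (Real.rpow_pos_of_pos hk.1 _).ne', hk.1⟩
      obtain ⟨n, hn⟩ := (Real.cos_eq_one_iff _).1 (sub_eq_zero.1 h).symm
      have hnk : (n : ℝ) = k := by
        have := Real.pi_pos
        field_simp at hn
        exact hn
      have h0 : (0 : ℝ) < n := hnk ▸ hk.1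
      have h1 : (n : ℝ) < 1 := hnk ▸ hk.2
      norm_cast at h0 h1
      omega
    exact (by simp : (0 : ℝ≥0∞) < volume (Ioo (0 : ℝ) 1)).trans_le (measure_mono hsub)
  · exact mul_nonneg (by linarith [Real.cos_le_one (2 * Real.pi * k)])
      (Real.rpow_nonneg (le_of_lt hk) _)

lemma integral_one_sub_cos_stableRadial (hα : α ∈ Ioo (0 : ℝ) 2) (a : ℝ) :
    ∫ k, (1 - Real.cos (2 * Real.pi * (a * k))) ∂stableRadial α = stableConst α * |a| ^ α := by
  have habs : ∀ k : ℝ, Real.cos (2 * Real.pi * (a * k)) = Real.cos (2 * Real.pi * (|a| * k)) := by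
    intro k
    rcases abs_choice a with h | h <;> rw [h]
    rw [← Real.cos_neg]
    ring_nf
  simp_rw [habs]
  rcases (abs_nonneg a).eq_or_lt with h0 | hpos
  · rw [← h0, Real.zero_rpow hα.1.ne']
    simp
  generalize |a| = b at hpos
  have hsub := integral_comp_mul_left_Ioi
    (fun k : ℝ => (1 - Real.cos (2 * Real.pi * k)) * k ^ (-1 - α)) 0 hpos
  rw [mul_zero, smul_eq_mul] at hsub
  rw [stableConst, integral_stableRadial, integral_stableRadial]
  have hb : ∫ k in Ioi (0 : ℝ), (1 - Real.cos (2 * Real.pi * (b * k))) * (b * k) ^ (-1 - α)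
      = b ^ (-1 - α)
        * ∫ k in Ioi (0 : ℝ), (1 - Real.cos (2 * Real.pi * (b * k))) * k ^ (-1 - α) := by
    rw [← integral_const_mul]
    refine setIntegral_congr_fun measurableSet_Ioi fun k hk => ?_
    rw [Real.mul_rpow hpos.le (le_of_lt hk)]
    ring
  rw [hb] at hsub
  have hp : b ^ α * b * b ^ (-1 - α) = 1 := by
    nth_rewrite 2 [← Real.rpow_one b]
    rw [← Real.rpow_add hpos, ← Real.rpow_add hpos, ← Real.rpow_zero b]
    ring_nf
  set I₁ := ∫ k in Ioi (0 : ℝ), (1 - Real.cos (2 * Real.pi * (b * k))) * k ^ (-1 - α)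
  set I₂ := ∫ k in Ioi (0 : ℝ), (1 - Real.cos (2 * Real.pi * k)) * k ^ (-1 - α)
  calc I₁ = b ^ α * b * (b ^ (-1 - α) * I₁) := by rw [← mul_assoc, hp, one_mul]
    _ = I₂ * b ^ α := by rw [hsub]; field_simp

variable {E : Type*} [NormedAddCommGroup E] [InnerProductSpace ℝ E] [MeasurableSpace E]
  [BorelSpace E]

/-- The `α`-stable Lévy measure with spectral measure `ν`, image of `ν(dξ) k^(-1-α) dk` under
polar coordinates `(ξ, k) ↦ kξ`. -/
def stableLevy (ν : Measure E) (α : ℝ) : Measure E :=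
  (ν.prod (stableRadial α)).map fun p => p.2 • p.1

lemma measurable_smul_swap : Measurable fun p : E × ℝ => p.2 • p.1 :=
  (by fun_prop : Continuous fun p : E × ℝ => p.2 • p.1).measurable

variable {ν : Measure E} [IsFiniteMeasure ν]

instance : SFinite (stableLevy ν α) :=
  inferInstanceAs (SFinite ((ν.prod (stableRadial α)).map _))

lemma integrable_levyWeight_stableLevy (hα : α ∈ Ioo (0 : ℝ) 2) (hν : ∀ᵐ ξ ∂ν, ‖ξ‖ = 1) :
    Integrable levyWeight (stableLevy ν α) := by
  have hc : Continuous (levyWeight : E → ℝ) := by unfold levyWeight; fun_prop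
  rw [stableLevy, integrable_map_measure hc.aestronglyMeasurable measurable_smul_swap.aemeasurable]
  refine ((integrable_levyWeight_stableRadial hα).comp_snd ν).congr ?_
  filter_upwards [Measure.quasiMeasurePreserving_fst.ae hν] with p hp
  simp [levyWeight, norm_smul, hp]

lemma integral_stableLevy {f : E → ℝ} (hf : Integrable f (stableLevy ν α)) :
    ∫ h, f h ∂stableLevy ν α = ∫ ξ, ∫ k, f (k • ξ) ∂stableRadial α ∂ν := by
  rw [stableLevy, integral_map measurable_smul_swap.aemeasurable hf.aestronglyMeasurable]
  exact integral_prod _ ((integrable_map_measure hf.aestronglyMeasurable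
    measurable_smul_swap.aemeasurable).1 hf)

lemma map_neg_stableLevy (hν : ν.map (fun x => -x) = ν) :
    (stableLevy ν α).map (fun x => -x) = stableLevy ν α := by
  have hmp : MeasurePreserving (Prod.map (fun x : E => -x) id) (ν.prod (stableRadial α))
      (ν.prod (stableRadial α)) :=
    MeasurePreserving.prod ⟨measurable_neg, hν⟩ (MeasurePreserving.id _)
  unfold stableLevy
  conv_rhs => rw [← hmp.map_eq, Measure.map_map measurable_smul_swap hmp.measurable]
  rw [Measure.map_map measurable_neg measurable_smul_swap]
  congr 1
  ext p
  simp

lemma levySymbol_stableLevy (hα : α ∈ Ioo (0 : ℝ) 2) (hν : ∀ᵐ ξ ∂ν, ‖ξ‖ = 1) (z : E) :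
    levySymbol (stableLevy ν α) z = stableConst α * ∫ ξ, |(⟪z, ξ⟫ : ℝ)| ^ α ∂ν := by
  rw [levySymbol, integral_stableLevy
    (integrable_one_sub_cos_inner (integrable_levyWeight_stableLevy hα hν) z),
    ← integral_const_mul]
  simp_rw [inner_smul_right, mul_comm _ ⟪z, _⟫, integral_one_sub_cos_stableRadial hα]

lemma integral_levyIntegrand_stableLevy {φ : E → ℝ} {x : E} (hν : ∀ᵐ ξ ∂ν, ‖ξ‖ = 1)
    (hφ : Integrable (levyIntegrand φ x) (stableLevy ν α)) :
    ∫ h, levyIntegrand φ x h ∂stableLevy ν α = ∫ ξ, (∫ k in Ioi (0 : ℝ),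
      (φ (x + k • ξ) - φ x - (if k ≤ 1 then k * fderiv ℝ φ x ξ else 0)) * k ^ (-1 - α)) ∂ν := by
  rw [integral_stableLevy hφ]
  refine integral_congr_ae ?_
  filter_upwards [hν] with ξ hξ
  rw [← integral_stableRadial α
    (fun k => φ (x + k • ξ) - φ x - (if k ≤ 1 then k * fderiv ℝ φ x ξ else 0))]
  refine integral_congr_ae ?_
  filter_upwards [ae_stableRadial_pos α] with k hk
  simp [levyIntegrand, norm_smul, hξ, abs_of_pos hk]

end Stable

/-- For `α ∈ (0,2)` there is a constant `C > 0` such that, weakly (tested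
against any Schwartz function `g`), `F⁻¹(ψ^α_ν · Fφ) = A φ` for every `φ ∈ C_b^∞`, where
`A` is the integro-differential operator `levyOp` above; i.e. `−L^α_ν` coincides on `C_b^∞`
with the generator of the `α`-stable Lévy process with Lévy measure
`μ(A) = C ∫_S ∫_0^∞ 1_A(kξ) k^{−1−α} dk ν(dξ)`.  (Becuase the Fourier multiplier `ψ^α_ν` is
even, `⟨F⁻¹(ψ^α_ν Fφ), g⟩ = ⟨φ, F⁻¹(ψ^α_ν Fg)⟩`, which is the pairing used below.) -/
theorem stmt3 {d : ℕ} (hd : 1 ≤ d) {α : ℝ} (hα : α ∈ Set.Ioo (0 : ℝ) 2)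
    (ν : Measure (Ed d)) [IsFiniteMeasure ν]
    (hsym : SymmMeasure ν) (hsph : OnSphere ν) (hne : ν ≠ 0) :
    ∃ C > (0 : ℝ), ∀ φ : Ed d → ℝ, CbSmooth φ → ∀ g : 𝓢(Ed d, ℂ),
      ∫ x, (φ x : ℂ) * 𝓕⁻ (fun ξ : Ed d => (psiNu ν α ξ : ℂ) * 𝓕 (⇑g) ξ) x
        = ∫ x, (levyOp ν α C φ x : ℂ) * g x := by
  have hν : ∀ᵐ ξ ∂ν, ‖ξ‖ = 1 := by
    filter_upwards [measure_eq_zero_iff_ae_notMem.1 hsph] with ξ hξ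
    simpa using hξ
  set μ := stableLevy ν α
  have hμ : Integrable levyWeight μ := integrable_levyWeight_stableLevy hα hν
  have hc := stableConst_pos hα
  refine ⟨(stableConst α)⁻¹, inv_pos.2 hc, fun φ hφ g => ?_⟩
  have hφ2 : ContDiff ℝ 2 φ := contDiff_infty.1 hφ.1 2
  obtain ⟨M₀, hM₀⟩ := hφ.2 0
  obtain ⟨M₂, hM₂⟩ := hφ.2 2
  simp only [norm_iteratedFDeriv_zero] at hM₀
  set Φ : Ed d → ℂ := fun x => (φ x : ℂ) with hΦ
  have hΦ2 : ContDiff ℝ 2 Φ := Complex.ofRealCLM.contDiff.comp hφ2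
  have hΦ₀ : ∀ x, ‖Φ x‖ ≤ M₀ := fun x => by simpa [hΦ] using hM₀ x
  have hΦ₂ : ∀ x, ‖iteratedFDeriv ℝ 2 Φ x‖ ≤ M₂ := fun x => by
    have := Complex.ofRealLI.norm_iteratedFDeriv_comp_left hφ2.contDiffAt (x := x) (i := 2) le_rfl
    exact this.trans_le (hM₂ x)
  have hsymbol : ∀ x, 𝓕⁻ (fun ξ : Ed d => (psiNu ν α ξ : ℂ) * 𝓕 (⇑g) ξ) x
      = -((stableConst α)⁻¹ / 2) * ∫ h, secondDiff g h x ∂μ := by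
    intro x
    have hψ : ∀ z, levySymbol μ z = stableConst α * psiNu ν α z :=
      levySymbol_stableLevy hα hν
    have h1 := SchwartzMap.fourierInv_levySymbol_mul_fourier hμ g x
    have hcC : (stableConst α : ℂ) ≠ 0 := by exact_mod_cast hc.ne'
    simp_rw [hψ, Complex.ofReal_mul, mul_assoc] at h1
    rw [Real.fourierInv_eq'] at h1 ⊢
    simp_rw [smul_eq_mul, mul_left_comm _ (stableConst α : ℂ)] at h1 ⊢
    rw [integral_const_mul] at h1
    rw [← mul_right_inj' hcC, h1]
    push_cast
    field_simp
  have hlevy : ∀ x, (levyOp ν α (stableConst α)⁻¹ φ x : ℂ)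
      = -((stableConst α)⁻¹ / 2) * ∫ h, secondDiff Φ h x ∂μ := by
    intro x
    have hint := integrable_levyIntegrand hμ hφ2 hM₀ hM₂
    have h1 : ∀ h, secondDiff Φ h x = ((secondDiff φ h x : ℝ) : ℂ) := fun h => by
      simp [secondDiff, hΦ]
    rw [levyOp, ← integral_levyIntegrand_stableLevy hν (hint x),
      integral_levyIntegrand_of_symm (map_neg_stableLevy hsym) hint]
    simp_rw [h1, integral_complex_ofReal]
    push_cast
    ring
  set c : ℂ := -(((stableConst α)⁻¹ : ℝ) / 2)
  calc ∫ x, (φ x : ℂ) * 𝓕⁻ (fun ξ : Ed d => (psiNu ν α ξ : ℂ) * 𝓕 (⇑g) ξ) x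
      = ∫ x, c * (Φ x * ∫ h, secondDiff g h x ∂μ) := by
        simp_rw [hsymbol]
        exact integral_congr_ae (ae_of_all _ fun x => mul_left_comm _ _ _)
    _ = ∫ x, c * ((∫ h, secondDiff Φ h x ∂μ) * g x) := by
        rw [integral_const_mul, integral_const_mul,
          SchwartzMap.integral_mul_integral_secondDiff_comm hμ hΦ2 hΦ₀ hΦ₂ g]
    _ = ∫ x, (levyOp ν α (stableConst α)⁻¹ φ x : ℂ) * g x := by
        simp_rw [hlevy, mul_assoc]

end
end

section
/- Let (p_j)_{j≥−1} be a smooth dyadic partition of unity on ℝ and set p̃_l := Σ_{l′ : |l′−l| ≤ 1} p_{l′} (with p_{−2} := 0). Let α > 3/2 and ε ∈ (0,1) be such that 3 − 2α(1−ε) < 0. Then there exists a constant C > 0 such that for every j ≥ −1: Σ_{k₁ ∈ ℤ∖{0}} Σ_{k₂ ∈ ℤ} Σ_{l₁ ≥ −1} p_j(k₁+k₂)² p_{l₁}(k₁)² p̃_{l₁}(k₂)² |k₁|^{2−2α(1−ε)} ≤ C 2^{j(4−2α(1−ε))}. -/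
open MeasureTheory Filter Topology Set
open scoped ENNReal

noncomputable section

/-- A smooth dyadic partition of unity on `ℝ`.  The index is shifted by one:
`p j` here is the paper's `p_{j−1}`, so `p 0, p 1` are the paper's `p_{−1}, p_0`. -/
structure DyadicPartition1 where
  p : ℕ → ℝ → ℝ
  smooth : ∀ j, ContDiff ℝ (⊤ : ℕ∞) (p j)
  compSupp : ∀ j, HasCompactSupport (p j)
  nonneg : ∀ j ≤ 1, ∀ x, 0 ≤ p j x
  even : ∀ j ≤ 1, ∀ x, p j (-x) = p j x
  ballSupp : ∃ R > 0, Function.support (p 0) ⊆ Metric.ball 0 R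
  annulusSupp : ∃ a b : ℝ, 0 < a ∧ a < b ∧
    Function.support (p 1) ⊆ {x : ℝ | a ≤ |x| ∧ |x| ≤ b}
  scaling : ∀ (j : ℕ) (x : ℝ), p (j + 1) x = p 1 ((2 : ℝ) ^ (-(j : ℤ)) * x)
  sum_one : ∀ x, HasSum (fun j => p j x) 1
  disj : ∀ i j : ℕ, 1 < |(i : ℤ) - j| → ∀ x, p i x * p j x = 0

/-- `p̃_l := Σ_{|l′−l| ≤ 1} p_{l′}` (with `p_{−2} := 0`). -/
def ptil (P : DyadicPartition1) (l : ℕ) (x : ℝ) : ℝ :=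
  (if l = 0 then 0 else P.p (l - 1) x) + P.p l x + P.p (l + 1) x

/-- Every function of a dyadic partition takes values in `[0, 1]`. -/
theorem DyadicPartition1.mem_Icc (P : DyadicPartition1) (j : ℕ) (x : ℝ) :
    P.p j x ∈ Set.Icc (0 : ℝ) 1 := by
  have hnonneg : ∀ i, 0 ≤ P.p i x := by
    intro i
    rcases i with _ | i
    · exact P.nonneg 0 (by norm_num) x
    · rw [P.scaling]
      exact P.nonneg 1 le_rfl _
  exact ⟨hnonneg j, le_hasSum (P.sum_one x) j fun i _ => hnonneg i⟩

/-- The supports of a dyadic partition are uniformly comparable to dyadic annuli. -/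
theorem DyadicPartition1.exists_support_bounds (P : DyadicPartition1) :
    ∃ m M : ℝ, 0 < m ∧ m ≤ 1 ∧ 1 ≤ M ∧
      (∀ (j : ℕ) (x : ℝ), P.p j x ≠ 0 → |x| ≤ M * 2 ^ j) ∧
      ∀ (j : ℕ) (x : ℝ), P.p j x ≠ 0 → j ≠ 0 → m * 2 ^ j ≤ |x| := by
  obtain ⟨R, _, hR⟩ := P.ballSupp
  obtain ⟨a, b, ha, _, hab⟩ := P.annulusSupp
  have hscale : ∀ (j : ℕ) (x : ℝ), P.p (j + 1) x ≠ 0 → a * 2 ^ j ≤ |x| ∧ |x| ≤ b * 2 ^ j := by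
    intro j x hx
    rw [P.scaling] at hx
    obtain ⟨h₁, h₂⟩ := hab hx
    have h2 : (0 : ℝ) < 2 ^ j := by positivity
    rw [abs_mul, zpow_neg, zpow_natCast, abs_of_pos (inv_pos.mpr h2), inv_mul_eq_div] at h₁ h₂
    exact ⟨(le_div_iff₀ h2).mp h₁, (div_le_iff₀ h2).mp h₂⟩
  refine ⟨min 1 (a / 2), max 1 (max R b), by positivity, min_le_left _ _, le_max_left _ _, ?_, ?_⟩
  · intro j x hx
    rcases j with _ | j
    · have h := hR hx
      rw [mem_ball_zero_iff, Real.norm_eq_abs] at h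
      have : R ≤ max 1 (max R b) := le_max_of_le_right (le_max_left _ _)
      rw [pow_zero, mul_one]
      linarith
    · refine (hscale j x hx).2.trans ?_
      have hb : b ≤ max 1 (max R b) := le_max_of_le_right (le_max_right _ _)
      exact mul_le_mul hb (pow_le_pow_right₀ one_le_two (Nat.le_succ j)) (by positivity)
        (by positivity)
  · intro j x hx hj
    obtain ⟨j, rfl⟩ := Nat.exists_eq_succ_of_ne_zero hj
    refine le_trans ?_ (hscale j x hx).1
    calc min 1 (a / 2) * 2 ^ (j + 1) ≤ a / 2 * 2 ^ (j + 1) := by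
          gcongr
          exact min_le_right _ _
      _ = a * 2 ^ j := by ring

/-- The enlarged functions `ptil P l` take values in `[0, 3]`. -/
theorem ptil_mem_Icc (P : DyadicPartition1) (l : ℕ) (x : ℝ) :
    ptil P l x ∈ Set.Icc (0 : ℝ) 3 := by
  obtain ⟨h₁, h₁'⟩ := P.mem_Icc (l - 1) x
  obtain ⟨h₂, h₂'⟩ := P.mem_Icc l x
  obtain ⟨h₃, h₃'⟩ := P.mem_Icc (l + 1) x
  unfold ptil
  split_ifs <;> constructor <;> linarith

/-- A bound on the supports of a dyadic partition transfers to the functions `ptil P l`. -/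
theorem abs_le_of_ptil_ne_zero {P : DyadicPartition1} {M : ℝ} (hM : 0 ≤ M)
    (hsupp : ∀ (j : ℕ) (x : ℝ), P.p j x ≠ 0 → |x| ≤ M * 2 ^ j) {l : ℕ} {x : ℝ}
    (hx : ptil P l x ≠ 0) : |x| ≤ M * 2 ^ (l + 1) := by
  have key : ∀ i ≤ l + 1, P.p i x ≠ 0 → |x| ≤ M * 2 ^ (l + 1) := fun i hi h =>
    (hsupp i x h).trans (by gcongr; exact one_le_two)
  by_contra hcon
  have hzero : ∀ i ≤ l + 1, P.p i x = 0 := fun i hi => by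
    by_contra h
    exact hcon (key i hi h)
  apply hx
  simp [ptil, hzero (l - 1) (by omega), hzero l (by omega), hzero (l + 1) le_rfl]

/-- An interval of radius `X` contains at most `2 X + 1` integers. -/
theorem tsum_int_abs_add_le (n : ℤ) {X : ℝ} (hX : 0 ≤ X) :
    (∑' k : ℤ, if |(n : ℝ) + (k : ℝ)| ≤ X then (1 : ℝ≥0∞) else 0) ≤
      ENNReal.ofReal (2 * X + 1) := by
  have hshift := (Equiv.addLeft n).tsum_eq fun k : ℤ => if |(k : ℝ)| ≤ X then (1 : ℝ≥0∞) else 0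
  simp only [Equiv.coe_addLeft, Int.cast_add] at hshift
  rw [hshift, tsum_eq_sum (s := Finset.Icc (-⌊X⌋) ⌊X⌋)]
  · have h0 : 0 ≤ ⌊X⌋ := Int.floor_nonneg.mpr hX
    calc (∑ k ∈ Finset.Icc (-⌊X⌋) ⌊X⌋, if |(k : ℝ)| ≤ X then (1 : ℝ≥0∞) else 0)
        ≤ ∑ k ∈ Finset.Icc (-⌊X⌋) ⌊X⌋, (1 : ℝ≥0∞) := by
          gcongr
          split_ifs <;> simp
      _ = ENNReal.ofReal ((Finset.Icc (-⌊X⌋) ⌊X⌋).card : ℝ) := by simp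
      _ ≤ ENNReal.ofReal (2 * X + 1) := by
          apply ENNReal.ofReal_le_ofReal
          have hcard : ((Finset.Icc (-⌊X⌋) ⌊X⌋).card : ℤ) = 2 * ⌊X⌋ + 1 := by
            rw [Int.card_Icc, Int.toNat_of_nonneg (by omega)]
            ring
          have hcard' : ((Finset.Icc (-⌊X⌋) ⌊X⌋).card : ℝ) = 2 * (⌊X⌋ : ℝ) + 1 := by
            exact_mod_cast hcard
          have := Int.floor_le X
          linarith
  · intro k hk
    rw [if_neg]
    intro h
    obtain ⟨h₁, h₂⟩ := abs_le.mp h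
    refine hk (Finset.mem_Icc.mpr ⟨?_, Int.le_floor.mpr h₂⟩)
    have : -k ≤ ⌊X⌋ := Int.le_floor.mpr (by push_cast; linarith)
    omega

/-- The tail of a geometric series, starting from the index `j - n`. -/
theorem tsum_geometric_tail_le {r : ℝ} (hr : 0 < r) (hr1 : r < 1) (n j : ℕ) :
    (∑' l : ℕ, if j ≤ l + n then ENNReal.ofReal (r ^ l) else 0) ≤
      ENNReal.ofReal (r ^ j * ((r ^ n)⁻¹ * (1 - r)⁻¹)) := by
  have hsum : (∑' i : ℕ, ENNReal.ofReal (r ^ j * (r ^ n)⁻¹ * r ^ i)) =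
      ENNReal.ofReal (r ^ j * ((r ^ n)⁻¹ * (1 - r)⁻¹)) := by
    rw [← ENNReal.ofReal_tsum_of_nonneg (fun i => by positivity)
      ((summable_geometric_of_lt_one hr.le hr1).mul_left _), tsum_mul_left,
      tsum_geometric_of_lt_one hr.le hr1, mul_assoc]
  rw [← hsum, ← tsum_subtype_eq_of_support_subset (s := {l : ℕ | j ≤ l + n})]
  · have hinj : Function.Injective fun l : {l : ℕ | j ≤ l + n} => (l : ℕ) + n - j := by
      rintro ⟨x, hx⟩ ⟨y, hy⟩ h
      simp only [Set.mem_ofPred_eq] at hx hy h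
      exact Subtype.ext (by simp only; omega)
    refine le_trans (le_of_eq (tsum_congr ?_)) (ENNReal.tsum_comp_le_tsum_of_injective hinj
      fun i => ENNReal.ofReal (r ^ j * (r ^ n)⁻¹ * r ^ i))
    rintro ⟨l, hl⟩
    simp only [Set.mem_ofPred_eq] at hl
    rw [if_pos hl]
    congr 1
    have hpow : r ^ j * r ^ (l + n - j) = r ^ l * r ^ n := by
      rw [← pow_add, ← pow_add]
      congr 1
      omega
    rw [mul_right_comm, hpow]
    field_simp
  · intro l hl
    by_contra h
    exact hl (if_neg h)

/-- Pointwise bound on the kernel by products of indicators of dyadic ranges. -/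
theorem exists_kernel_term_le (P : DyadicPartition1) {s : ℝ} (hs : s < 0) :
    ∃ (M K : ℝ) (n : ℕ), 1 ≤ M ∧ 0 < K ∧ ∀ (j l : ℕ) (k₁ k₂ : ℤ),
      ENNReal.ofReal (if k₁ ≠ 0 then P.p j ((k₁ : ℝ) + (k₂ : ℝ)) ^ 2 * P.p l (k₁ : ℝ) ^ 2 *
          ptil P l (k₂ : ℝ) ^ 2 * |(k₁ : ℝ)| ^ s else 0) ≤
        (if j ≤ l + n then ENNReal.ofReal (K * (2 ^ s) ^ l) else 0) *
          ((if |(k₁ : ℝ)| ≤ M * 2 ^ l then 1 else 0) *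
            (if |(k₁ : ℝ) + (k₂ : ℝ)| ≤ M * 2 ^ j then 1 else 0)) := by
  obtain ⟨m, M, hm, hm1, hM, hupper, hlower⟩ := P.exists_support_bounds
  obtain ⟨n, hn⟩ := pow_unbounded_of_one_lt (3 * M / m) (one_lt_two (α := ℝ))
  refine ⟨M, 9 * m ^ s, n, hM, by positivity, fun j l k₁ k₂ => ?_⟩
  by_cases hk : k₁ = 0
  · simp [hk]
  rw [if_pos hk]
  by_cases hj : P.p j ((k₁ : ℝ) + (k₂ : ℝ)) = 0
  · simp [hj]
  by_cases hl : P.p l (k₁ : ℝ) = 0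
  · simp [hl]
  by_cases ht : ptil P l (k₂ : ℝ) = 0
  · simp [ht]
  have hk1 : (1 : ℝ) ≤ |(k₁ : ℝ)| := by exact_mod_cast Int.one_le_abs hk
  have hk₁_lower : m * 2 ^ l ≤ |(k₁ : ℝ)| := by
    by_cases h0 : l = 0
    · subst h0
      rw [pow_zero, mul_one]
      exact hm1.trans hk1
    · exact hlower l _ hl h0
  have hk₁_upper := hupper l _ hl
  have hk₂_upper := abs_le_of_ptil_ne_zero (by linarith) hupper ht
  have hjl : j ≤ l + n := by
    by_cases h0 : j = 0
    · omega
    have h₁ := hlower j _ hj h0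
    have h₂ := abs_add_le (k₁ : ℝ) (k₂ : ℝ)
    rw [div_lt_iff₀ hm] at hn
    have h2l : (0 : ℝ) < 2 ^ l := by positivity
    have h₃ : m * (2 : ℝ) ^ j ≤ m * 2 ^ (l + n) := by
      have := mul_le_mul_of_nonneg_right hn.le h2l.le
      rw [pow_succ] at hk₂_upper
      rw [pow_add]
      linarith
    exact (pow_le_pow_iff_right₀ one_lt_two).mp (le_of_mul_le_mul_left h₃ hm)
  rw [if_pos hjl, if_pos hk₁_upper, if_pos (hupper j _ hj), mul_one, mul_one]
  apply ENNReal.ofReal_le_ofReal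
  obtain ⟨hj0, hj1⟩ := P.mem_Icc j ((k₁ : ℝ) + (k₂ : ℝ))
  obtain ⟨hl0, hl1⟩ := P.mem_Icc l (k₁ : ℝ)
  obtain ⟨ht0, ht3⟩ := ptil_mem_Icc P l (k₂ : ℝ)
  have hpow : |(k₁ : ℝ)| ^ s ≤ m ^ s * (2 ^ s) ^ l := by
    refine (Real.rpow_le_rpow_of_nonpos (by positivity) hk₁_lower hs.le).trans (le_of_eq ?_)
    rw [Real.mul_rpow hm.le (by positivity), Real.rpow_pow_comm zero_le_two]
  calc _ ≤ (1 : ℝ) ^ 2 * 1 ^ 2 * 3 ^ 2 * (m ^ s * (2 ^ s) ^ l) := by gcongr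
    _ = _ := by ring

/-- For `α > 3/2` and `ε ∈ (0,1)` with `3 − 2α(1−ε) < 0`, the kernel sum
`Σ_{k₁≠0,k₂,l₁} p_j(k₁+k₂)² p_{l₁}(k₁)² p̃_{l₁}(k₂)² |k₁|^{2−2α(1−ε)}`
is bounded by `C 2^{j(4−2α(1−ε))}` uniformly in `j ≥ −1`.
(The outer index `j : ℕ` denotes the paper's `j−1 ∈ {−1,0,1,…}`.) -/
theorem stmt19 (P : DyadicPartition1) {α ε : ℝ} (hα : 3 / 2 < α) (hε : ε ∈ Set.Ioo (0 : ℝ) 1)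
    (hcrit : 3 - 2 * α * (1 - ε) < 0) :
    ∃ C > (0 : ℝ), ∀ j : ℕ,
      (∑' (k : ℤ × ℤ) (l : ℕ), ENNReal.ofReal (
          if k.1 ≠ 0 then
            P.p j ((k.1 : ℝ) + (k.2 : ℝ)) ^ 2 * P.p l (k.1 : ℝ) ^ 2 *
              ptil P l (k.2 : ℝ) ^ 2 * |(k.1 : ℝ)| ^ (2 - 2 * α * (1 - ε))
          else 0))
        ≤ ENNReal.ofReal (C * 2 ^ (((j : ℝ) - 1) * (4 - 2 * α * (1 - ε)))) := by
  set s : ℝ := 2 - 2 * α * (1 - ε) with hs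
  have hs1 : s < -1 := by linarith
  obtain ⟨M, K, n, hM, hK, hterm⟩ := exists_kernel_term_le P (by linarith : s < 0)
  set r : ℝ := 2 ^ (s + 1) with hr
  have hr0 : 0 < r := by positivity
  have hr1 : r < 1 := Real.rpow_lt_one_of_one_lt_of_neg one_lt_two (by linarith)
  have hr1' : 0 < 1 - r := by linarith
  refine ⟨K * (3 * M) ^ 2 * ((r ^ n)⁻¹ * (1 - r)⁻¹) * 2 ^ (s + 2), by positivity, fun j => ?_⟩
  have hcount : ∀ (i : ℕ) (a : ℤ),
      (∑' k : ℤ, if |(a : ℝ) + (k : ℝ)| ≤ M * 2 ^ i then (1 : ℝ≥0∞) else 0) ≤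
        ENNReal.ofReal (3 * M * 2 ^ i) := by
    intro i a
    refine (tsum_int_abs_add_le a (by positivity)).trans (ENNReal.ofReal_le_ofReal ?_)
    have := one_le_mul_of_one_le_of_one_le hM (one_le_pow₀ (n := i) (one_le_two (α := ℝ)))
    linarith
  have hcount₀ : ∀ i : ℕ,
      (∑' k : ℤ, if |(k : ℝ)| ≤ M * 2 ^ i then (1 : ℝ≥0∞) else 0) ≤
        ENNReal.ofReal (3 * M * 2 ^ i) := by
    intro i
    simpa using hcount i 0
  have htwo : (2 : ℝ) ^ s * 2 = r := by
    rw [hr, Real.rpow_add_one two_ne_zero]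
  have hpairs : ∀ l : ℕ, (∑' k : ℤ × ℤ,
      (if |(k.1 : ℝ)| ≤ M * 2 ^ l then (1 : ℝ≥0∞) else 0) *
        (if |(k.1 : ℝ) + (k.2 : ℝ)| ≤ M * 2 ^ j then 1 else 0)) ≤
      ENNReal.ofReal (3 * M * 2 ^ l) * ENNReal.ofReal (3 * M * 2 ^ j) := by
    intro l
    rw [ENNReal.tsum_prod']
    refine (ENNReal.tsum_le_tsum fun a => ?_).trans
      ((ENNReal.tsum_mul_right (a := ENNReal.ofReal (3 * M * 2 ^ j))).le.trans
        (mul_le_mul_left (hcount₀ l) _))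
    exact ENNReal.tsum_mul_left.le.trans (mul_le_mul_right (hcount j a) _)
  calc _ ≤ ∑' (k : ℤ × ℤ) (l : ℕ),
        (if j ≤ l + n then ENNReal.ofReal (K * (2 ^ s) ^ l) else 0) *
          ((if |(k.1 : ℝ)| ≤ M * 2 ^ l then 1 else 0) *
            (if |(k.1 : ℝ) + (k.2 : ℝ)| ≤ M * 2 ^ j then 1 else 0)) :=
        ENNReal.tsum_le_tsum fun k => ENNReal.tsum_le_tsum fun l => hterm j l k.1 k.2
    _ ≤ ∑' l : ℕ, (if j ≤ l + n then ENNReal.ofReal (K * (2 ^ s) ^ l) else 0) *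
          (ENNReal.ofReal (3 * M * 2 ^ l) * ENNReal.ofReal (3 * M * 2 ^ j)) := by
        rw [ENNReal.tsum_comm]
        refine ENNReal.tsum_le_tsum fun l => ?_
        rw [ENNReal.tsum_mul_left]
        exact mul_le_mul_right (hpairs l) _
    _ = ENNReal.ofReal (K * (3 * M) ^ 2 * 2 ^ j) *
          ∑' l : ℕ, if j ≤ l + n then ENNReal.ofReal (r ^ l) else 0 := by
        rw [← ENNReal.tsum_mul_left]
        refine tsum_congr fun l => ?_
        split_ifs
        · rw [← ENNReal.ofReal_mul (by positivity), ← ENNReal.ofReal_mul (by positivity),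
            ← ENNReal.ofReal_mul (by positivity), ← htwo, mul_pow]
          congr 1
          ring
        · simp
    _ ≤ ENNReal.ofReal (K * (3 * M) ^ 2 * 2 ^ j) *
          ENNReal.ofReal (r ^ j * ((r ^ n)⁻¹ * (1 - r)⁻¹)) :=
        mul_le_mul_right (tsum_geometric_tail_le hr0 hr1 n j) _
    _ = _ := by
        rw [← ENNReal.ofReal_mul (by positivity)]
        congr 1
        have hexp : (2 : ℝ) ^ (s + 2) * 2 ^ (((j : ℝ) - 1) * (4 - 2 * α * (1 - ε))) =
            2 ^ j * r ^ j := by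
          rw [hr, ← Real.rpow_natCast 2 j, ← Real.rpow_mul_natCast zero_le_two,
            ← Real.rpow_add two_pos, ← Real.rpow_add two_pos]
          congr 1
          rw [hs]
          ring
        rw [mul_assoc _ ((2 : ℝ) ^ (s + 2)), hexp]
        ring

end
end
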